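/- arXiv:0907.1137 — 4 statements merged into one kernel-verified Lean document; each statement's English description precedes it below -/
import Mathlib

section
/- Let J, J' ⊆ S and x ∈ W. Then w₀^{J'} ▷ (x ◁ w₀^J) is the unique element of minimal length in the double coset W_{J'} x W_J, and w₀^{J'} ∗ (x ∗ w₀^J) is the unique element of maximal length in W_{J'} x W_J; that is, w₀^{J'} ▷ x ◁ w₀^J = min(W_{J'} x W_J) and w₀^{J'} ∗ x ∗ w₀^J = max(W_{J'} x W_J). -/
/-! Common setup: a finite Coxeter system, Bruhat order, and the sets
`{u * y : u ≤ x}` and `{x * v : v ≤ y}` used to characterize the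
Demazure product `∗` and the operations `▷`, `◁`. -/

/-- The Bruhat order on a Coxeter group: the reflexive-transitive closure of
the relation `u → u * t`, where `t` is a reflection and right multiplication
by `t` increases length. -/
def CoxeterSystem.bruhatLE {B W : Type*} [Group W] {M : CoxeterMatrix B}
    (cs : CoxeterSystem M W) : W → W → Prop :=
  Relation.ReflTransGen
    (fun u v => ∃ t, cs.IsReflection t ∧ v = u * t ∧ cs.length u < cs.length v)

/-- The set `{u * y : u ∈ W, u ≤ x}`. -/
def CoxeterSystem.lset {B W : Type*} [Group W] {M : CoxeterMatrix B}
    (cs : CoxeterSystem M W) (x y : W) : Set W :=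
  {z | ∃ u, cs.bruhatLE u x ∧ z = u * y}

/-- The set `{x * v : v ∈ W, v ≤ y}`. -/
def CoxeterSystem.rset {B W : Type*} [Group W] {M : CoxeterMatrix B}
    (cs : CoxeterSystem M W) (x y : W) : Set W :=
  {z | ∃ v, cs.bruhatLE v y ∧ z = x * v}

namespace CoxeterSystem

variable {B W : Type*} [Group W] {M : CoxeterMatrix B} (cs : CoxeterSystem M W)

theorem bruhatLE_refl (u : W) : cs.bruhatLE u u := Relation.ReflTransGen.refl

variable {cs}

theorem bruhatLE.trans {u v w : W} (h₁ : cs.bruhatLE u v) (h₂ : cs.bruhatLE v w) :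
    cs.bruhatLE u w :=
  Relation.ReflTransGen.trans h₁ h₂

theorem bruhatLE.eq_or_length_lt {u v : W} (h : cs.bruhatLE u v) :
    u = v ∨ cs.length u < cs.length v := by
  induction h with
  | refl => exact Or.inl rfl
  | tail _ hst ih =>
    obtain ⟨t, -, -, hlt⟩ := hst
    rcases ih with rfl | ih
    · exact Or.inr hlt
    · exact Or.inr (ih.trans hlt)

theorem bruhatLE.length_le {u v : W} (h : cs.bruhatLE u v) : cs.length u ≤ cs.length v := by
  rcases h.eq_or_length_lt with rfl | h
  · exact le_rfl
  · exact h.le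

theorem bruhatLE.eq_of_length_le {u v : W} (h : cs.bruhatLE u v)
    (hl : cs.length v ≤ cs.length u) : u = v :=
  h.eq_or_length_lt.resolve_right hl.not_gt

theorem bruhatLE.antisymm {u v : W} (h₁ : cs.bruhatLE u v) (h₂ : cs.bruhatLE v u) : u = v :=
  h₁.eq_of_length_le h₂.length_le

theorem IsReflection.bruhatLE_mul {t : W} (ht : cs.IsReflection t) {u : W}
    (h : cs.length u < cs.length (u * t)) : cs.bruhatLE u (u * t) :=
  Relation.ReflTransGen.single ⟨t, ht, rfl, h⟩

theorem bruhatLE_mul_simple {u : W} {i : B} (h : cs.length u < cs.length (u * cs.simple i)) :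
    cs.bruhatLE u (u * cs.simple i) :=
  (cs.isReflection_simple i).bruhatLE_mul h

theorem bruhatLE.inv {u v : W} (h : cs.bruhatLE u v) : cs.bruhatLE u⁻¹ v⁻¹ := by
  induction h with
  | refl => exact cs.bruhatLE_refl _
  | @tail b c _ hst ih =>
    obtain ⟨t, ht, rfl, hlt⟩ := hst
    refine ih.trans (Relation.ReflTransGen.single ⟨b * t * b⁻¹, ht.conj b, ?_, ?_⟩)
    · rw [mul_inv_rev, ht.inv]; group
    · simpa only [length_inv] using hlt

theorem bruhatLE_simple_mul {u : W} {i : B} (h : cs.length u < cs.length (cs.simple i * u)) :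
    cs.bruhatLE u (cs.simple i * u) := by
  have h' : cs.length u⁻¹ < cs.length (u⁻¹ * cs.simple i) := by
    rw [length_inv, ← cs.inv_simple i, ← mul_inv_rev, length_inv]
    exact h
  simpa using (bruhatLE_mul_simple h').inv

variable (cs)

/-- One half of the lifting property of the Bruhat order: the set of elements below `w` is stable
under right multiplication by every right descent of `w`. -/
def HasBruhatLifting : Prop :=
  ∀ ⦃u w : W⦄ ⦃i : B⦄, cs.bruhatLE u w → cs.IsRightDescent w i → cs.bruhatLE (u * cs.simple i) w

variable {cs}

/-- The existence of a maximum of each set `{u * s : u ≤ x}`, with `s` simple, gives the lifting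
property. -/
theorem hasBruhatLifting_of_isGreatest
    (h : ∀ (x : W) (i : B), ∃ y ∈ cs.lset x (cs.simple i),
      ∀ z ∈ cs.lset x (cs.simple i), cs.bruhatLE z y) : cs.HasBruhatLifting := by
  intro u w i huw hw
  obtain ⟨y, ⟨v, hv, rfl⟩, hy⟩ := h w i
  have hws : cs.bruhatLE (w * cs.simple i) w := by
    simpa using bruhatLE_mul_simple (cs := cs) (u := w * cs.simple i) (i := i)
      (by rwa [simple_mul_simple_cancel_right])
  have hwv : cs.bruhatLE w (v * cs.simple i) := hy _ ⟨_, hws, by simp⟩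
  have hl : cs.length (v * cs.simple i) ≤ cs.length w := by
    have h₁ := cs.length_mul_simple v i
    rcases hv.eq_or_length_lt with rfl | hlt
    · exact hw.le
    · omega
  rw [hwv.eq_of_length_le hl]
  exact hy _ ⟨u, huw, rfl⟩

namespace HasBruhatLifting

theorem simple_mul (hZ : cs.HasBruhatLifting)
    {u w : W} {i : B} (h : cs.bruhatLE u w) (hw : cs.IsLeftDescent w i) :
    cs.bruhatLE (cs.simple i * u) w := by
  simpa using (hZ h.inv (cs.isRightDescent_inv_iff.2 hw)).inv

/-- The folding condition. -/
theorem simple_mul_eq_mul_simple (hZ : cs.HasBruhatLifting)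
    {w : W} {i j : B} (h₁ : cs.length w < cs.length (cs.simple i * w))
    (h₂ : cs.length w < cs.length (w * cs.simple j))
    (h : cs.length (cs.simple i * w * cs.simple j) < cs.length (cs.simple i * w)) :
    cs.simple i * w = w * cs.simple j := by
  refine ((hZ (bruhatLE_simple_mul h₁) h).eq_of_length_le ?_).symm
  have := cs.length_simple_mul w i
  omega

theorem exists_sublist_wordProd_eq (hZ : cs.HasBruhatLifting)
    (ω : List B) {i : B} (h : cs.IsRightDescent (cs.wordProd ω) i) :
    ∃ ω' : List B, ω'.Sublist ω ∧ ω'.length < ω.length ∧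
      cs.wordProd ω' = cs.wordProd ω * cs.simple i := by
  induction ω with
  | nil => exact absurd (by simpa using h) (cs.not_isRightDescent_one i)
  | cons j ω ih =>
    by_cases hz : cs.IsRightDescent (cs.wordProd ω) i
    · obtain ⟨ω', hs, hl, hp⟩ := ih hz
      exact ⟨j :: ω', hs.cons_cons j, by simpa using hl, by simp [wordProd_cons, hp, mul_assoc]⟩
    · rw [cs.not_isRightDescent_iff] at hz
      rw [IsRightDescent, wordProd_cons] at h
      have h₁ := cs.length_simple_mul (cs.wordProd ω * cs.simple i) j
      rw [← mul_assoc] at h₁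
      have := hZ.simple_mul_eq_mul_simple (w := cs.wordProd ω) (i := j) (j := i)
        (by omega) (by omega) h
      exact ⟨ω, List.sublist_cons_self j ω, by simp, by simp [wordProd_cons, this]⟩

theorem exists_mul_eq (hZ : cs.HasBruhatLifting)
    {x y : W} {i : B} (hy : cs.length y < cs.length (y * cs.simple i))
    (h : cs.IsRightDescent (x * y) i) :
    ∃ x', cs.length x' < cs.length x ∧ x * y * cs.simple i = x' * y := by
  suffices key : ∀ ω : List B, cs.IsRightDescent (cs.wordProd ω * y) i →
      ∃ x', cs.length x' < ω.length ∧ cs.wordProd ω * y * cs.simple i = x' * y by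
    obtain ⟨ω, hω, rfl⟩ := cs.exists_isReduced x
    rw [hω.eq]
    exact key ω h
  intro ω
  induction ω with
  | nil =>
    intro h
    rw [wordProd_nil, one_mul, IsRightDescent] at h
    omega
  | cons j ω ih =>
    intro h
    by_cases hz : cs.IsRightDescent (cs.wordProd ω * y) i
    · obtain ⟨x', hl, hp⟩ := ih hz
      refine ⟨cs.simple j * x', ?_, ?_⟩
      · have := cs.length_simple_mul x' j
        simp only [List.length_cons]
        omega
      · rw [mul_assoc _ x', ← hp, wordProd_cons]; group
    · rw [cs.not_isRightDescent_iff] at hz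
      rw [IsRightDescent, wordProd_cons, mul_assoc (cs.simple j)] at h
      have h₁ := cs.length_simple_mul (cs.wordProd ω * y * cs.simple i) j
      rw [← mul_assoc] at h₁
      have := hZ.simple_mul_eq_mul_simple (w := cs.wordProd ω * y) (i := j) (j := i)
        (by omega) (by omega) h
      refine ⟨cs.wordProd ω, Nat.lt_succ_of_le (cs.length_wordProd_le ω), ?_⟩
      rw [wordProd_cons, mul_assoc (cs.simple j), this]
      simp

theorem eq_or_length_mul_simple_lt (hZ : cs.HasBruhatLifting)
    {u t : W} (ht : cs.IsReflection t)
    (hlt : cs.length u < cs.length (u * t)) (i : B) :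
    u * cs.simple i = u * t ∨ cs.length (u * cs.simple i) < cs.length (u * t * cs.simple i) := by
  by_contra! hcon
  obtain ⟨hne, hle⟩ := hcon
  have hr : cs.IsReflection (cs.simple i * t * cs.simple i) := by
    simpa using ht.conj (cs.simple i)
  have hne' : cs.length (u * t * cs.simple i) ≠ cs.length (u * cs.simple i) := by
    have := hr.length_mul_left_ne (u * cs.simple i)
    simpa [mul_assoc] using this
  have h₁ := cs.length_mul_simple u i
  have h₂ := cs.length_mul_simple (u * t) i
  refine hne ((hZ (ht.bruhatLE_mul hlt) (i := i) ?_).eq_of_length_le ?_)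
  · rw [IsRightDescent]; omega
  · omega

theorem bruhatLE_mul_simple_of_lt (hZ : cs.HasBruhatLifting)
    {u v : W} {i : B} (h : cs.bruhatLE u v)
    (hu : cs.length u < cs.length (u * cs.simple i)) : cs.bruhatLE u (v * cs.simple i) := by
  induction h with
  | refl => exact bruhatLE_mul_simple hu
  | @tail b c hub hst ih =>
    obtain ⟨t, ht, rfl, hlt⟩ := hst
    rcases hZ.eq_or_length_mul_simple_lt ht hlt i with h | h
    · rw [← h]
      rwa [simple_mul_simple_cancel_right]
    · refine ih.trans (Relation.ReflTransGen.single
        ⟨cs.simple i * t * cs.simple i, ?_, ?_, h⟩)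
      · simpa using ht.conj (cs.simple i)
      · simp [mul_assoc]

theorem bruhatLE_simple_mul_of_lt (hZ : cs.HasBruhatLifting)
    {u v : W} {i : B} (h : cs.bruhatLE u v)
    (hu : cs.length u < cs.length (cs.simple i * u)) : cs.bruhatLE u (cs.simple i * v) := by
  have h' : cs.length u⁻¹ < cs.length (u⁻¹ * cs.simple i) := by
    rw [length_inv, ← cs.inv_simple i, ← mul_inv_rev, length_inv]
    exact hu
  simpa using (hZ.bruhatLE_mul_simple_of_lt h.inv h').inv

end HasBruhatLifting

section Parabolic

variable {J : Set W}

theorem mul_mem_closure_induction (hJ : J ⊆ Set.range cs.simple) {p : W → Prop}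
    (hp : ∀ i, cs.simple i ∈ J → ∀ z, p z → p (z * cs.simple i)) {z b : W} (hz : p z)
    (hb : b ∈ Subgroup.closure J) : p (z * b) := by
  induction hb using Subgroup.closure_induction_right with
  | one => simpa using hz
  | mul_right b _ s hs ih =>
    obtain ⟨i, rfl⟩ := hJ hs
    rw [← mul_assoc]
    exact hp i hs _ ih
  | mul_inv_cancel b _ s hs ih =>
    obtain ⟨i, rfl⟩ := hJ hs
    rw [inv_simple, ← mul_assoc]
    exact hp i hs _ ih

theorem closure_mul_mem_induction (hJ : J ⊆ Set.range cs.simple) {p : W → Prop}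
    (hp : ∀ i, cs.simple i ∈ J → ∀ z, p z → p (cs.simple i * z)) {z b : W} (hz : p z)
    (hb : b ∈ Subgroup.closure J) : p (b * z) := by
  have := mul_mem_closure_induction (cs := cs) hJ (p := fun w ↦ p w⁻¹)
    (fun i hi w hw ↦ by simpa using hp i hi _ hw) (z := z⁻¹) (by simpa using hz) (inv_mem hb)
  simpa using this

theorem isRightDescent_of_forall_length_le {w : W}
    (hw : ∀ b ∈ Subgroup.closure J, cs.length (w * b) ≤ cs.length w) {i : B}
    (hi : cs.simple i ∈ J) : cs.IsRightDescent w i :=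
  (hw _ (Subgroup.subset_closure hi)).lt_of_ne (cs.length_mul_simple_ne w i)

namespace HasBruhatLifting

theorem exists_isReduced_of_mem_closure (hZ : cs.HasBruhatLifting) (hJ : J ⊆ Set.range cs.simple)
    {w : W} (hw : w ∈ Subgroup.closure J) :
    ∃ ω : List B, (∀ i ∈ ω, cs.simple i ∈ J) ∧ cs.IsReduced ω ∧ cs.wordProd ω = w := by
  have := mul_mem_closure_induction (cs := cs) hJ
    (p := fun w ↦ ∃ ω : List B, (∀ i ∈ ω, cs.simple i ∈ J) ∧ cs.IsReduced ω ∧ cs.wordProd ω = w)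
    ?_ ⟨[], by simp, by simp [IsReduced], cs.wordProd_nil⟩ hw
  · simpa using this
  rintro i hi _ ⟨ω, hω, hr, rfl⟩
  by_cases h : cs.IsRightDescent (cs.wordProd ω) i
  · obtain ⟨ω', hs, hl, hp⟩ := hZ.exists_sublist_wordProd_eq ω h
    refine ⟨ω', fun j hj ↦ hω j (hs.subset hj), ?_, hp⟩
    have h₁ := cs.length_wordProd_le ω'
    have h₂ := cs.length_mul_simple (cs.wordProd ω) i
    rw [← hp, hr.eq] at h₂
    rw [IsReduced]
    omega
  · refine ⟨ω ++ [i], ?_, ?_, by simp [wordProd_append]⟩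
    · intro j hj
      rcases List.mem_append.1 hj with hj | hj
      · exact hω j hj
      · rwa [List.mem_singleton.1 hj]
    · rw [cs.not_isRightDescent_iff] at h
      simp [IsReduced, wordProd_append, h, hr.eq]

theorem exists_isRightDescent_of_mem_closure (hZ : cs.HasBruhatLifting)
    (hJ : J ⊆ Set.range cs.simple) {w : W} (hw : w ∈ Subgroup.closure J) (hne : w ≠ 1) :
    ∃ i, cs.simple i ∈ J ∧ cs.IsRightDescent w i := by
  obtain ⟨ω, hω, hr, rfl⟩ := hZ.exists_isReduced_of_mem_closure hJ hw
  rcases List.eq_nil_or_concat' ω with rfl | ⟨ω', i, rfl⟩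
  · simp at hne
  · refine ⟨i, hω i (by simp), ?_⟩
    have h := cs.length_wordProd_le ω'
    rw [IsRightDescent, hr.eq]
    simpa [wordProd_append] using Nat.lt_succ_of_le h

theorem mem_closure_of_mul_reflection_mem (hZ : cs.HasBruhatLifting)
    (hJ : J ⊆ Set.range cs.simple) {u t : W} (ht : cs.IsReflection t)
    (hlt : cs.length u < cs.length (u * t)) (hv : u * t ∈ Subgroup.closure J) :
    u ∈ Subgroup.closure J := by
  induction hn : cs.length (u * t) using Nat.strong_induction_on generalizing u t with
  | _ n ih =>
    have hne : u * t ≠ 1 := by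
      intro h
      simp [h] at hlt
    obtain ⟨i, hi, hd⟩ := hZ.exists_isRightDescent_of_mem_closure hJ hv hne
    have hmem := Subgroup.subset_closure (k := J) hi
    rcases hZ.eq_or_length_mul_simple_lt ht hlt i with h | h
    · rwa [← h, Subgroup.mul_mem_cancel_right _ hmem] at hv
    · have he : u * cs.simple i * (cs.simple i * t * cs.simple i) = u * t * cs.simple i := by
        simp [mul_assoc]
      have hr : cs.IsReflection (cs.simple i * t * cs.simple i) := by
        simpa using ht.conj (cs.simple i)
      have := ih _ (hd.trans_eq hn) hr (u := u * cs.simple i) (by rwa [he])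
        (by rw [he]; exact mul_mem hv hmem) (by rw [he])
      rwa [Subgroup.mul_mem_cancel_right _ hmem] at this

theorem mem_closure_of_bruhatLE (hZ : cs.HasBruhatLifting) (hJ : J ⊆ Set.range cs.simple)
    {u v : W} (h : cs.bruhatLE u v) (hv : v ∈ Subgroup.closure J) :
    u ∈ Subgroup.closure J := by
  induction h using Relation.ReflTransGen.head_induction_on with
  | refl => exact hv
  | head hst _ ih =>
    obtain ⟨t, ht, rfl, hlt⟩ := hst
    exact hZ.mem_closure_of_mul_reflection_mem hJ ht hlt ih

theorem mul_bruhatLE (hZ : cs.HasBruhatLifting) (hJ : J ⊆ Set.range cs.simple)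
    {u w b : W} (hw : ∀ i, cs.simple i ∈ J → cs.IsRightDescent w i)
    (h : cs.bruhatLE u w) (hb : b ∈ Subgroup.closure J) : cs.bruhatLE (u * b) w :=
  mul_mem_closure_induction hJ (p := fun z ↦ cs.bruhatLE z w)
    (fun i hi _ hz ↦ hZ hz (hw i hi)) h hb

theorem mul_left_bruhatLE (hZ : cs.HasBruhatLifting) (hJ : J ⊆ Set.range cs.simple)
    {u w a : W} (hw : ∀ i, cs.simple i ∈ J → cs.IsLeftDescent w i)
    (h : cs.bruhatLE u w) (ha : a ∈ Subgroup.closure J) : cs.bruhatLE (a * u) w :=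
  closure_mul_mem_induction hJ (p := fun z ↦ cs.bruhatLE z w)
    (fun i hi _ hz ↦ hZ.simple_mul hz (hw i hi)) h ha

theorem bruhatLE_mul_left (hZ : cs.HasBruhatLifting) (hJ : J ⊆ Set.range cs.simple)
    {u w a : W}
    (hu : ∀ i, cs.simple i ∈ J → cs.length u < cs.length (cs.simple i * u))
    (h : cs.bruhatLE u w) (ha : a ∈ Subgroup.closure J) : cs.bruhatLE u (a * w) :=
  closure_mul_mem_induction hJ (p := fun z ↦ cs.bruhatLE u z)
    (fun i hi _ hz ↦ hZ.bruhatLE_simple_mul_of_lt hz (hu i hi)) h ha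

/-- The elements below the longest element of a parabolic subgroup are those of the subgroup. -/
theorem bruhatLE_longest_iff (hZ : cs.HasBruhatLifting) (hJ : J ⊆ Set.range cs.simple)
    {w₀ : W} (hw₀ : w₀ ∈ Subgroup.closure J ∧
    ∀ w ∈ Subgroup.closure J, cs.length w ≤ cs.length w₀) {u : W} :
    cs.bruhatLE u w₀ ↔ u ∈ Subgroup.closure J := by
  refine ⟨fun h ↦ hZ.mem_closure_of_bruhatLE hJ h hw₀.1, fun hu ↦ ?_⟩
  have := hZ.mul_bruhatLE hJ (fun i hi ↦ isRightDescent_of_forall_length_le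
    (fun b hb ↦ hw₀.2 _ (mul_mem hw₀.1 hb)) hi) (cs.bruhatLE_refl w₀)
    (mul_mem (inv_mem hw₀.1) hu)
  simpa using this

theorem length_mul_of_forall_length_le (hZ : cs.HasBruhatLifting) (hJ : J ⊆ Set.range cs.simple)
    {m : W}
    (hm : ∀ b ∈ Subgroup.closure J, cs.length m ≤ cs.length (m * b)) {b : W}
    (hb : b ∈ Subgroup.closure J) : cs.length (m * b) = cs.length m + cs.length b := by
  induction hn : cs.length b using Nat.strong_induction_on generalizing b with
  | _ n ih =>
    rcases eq_or_ne b 1 with rfl | hne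
    · simp [← hn]
    obtain ⟨i, hi, hd⟩ := hZ.exists_isRightDescent_of_mem_closure hJ hb hne
    have hmem := mul_mem hb (Subgroup.subset_closure hi)
    have h := ih _ (hn ▸ hd) hmem rfl
    have hd' := cs.isRightDescent_iff.1 hd
    have hnd : ¬ cs.IsRightDescent (m * (b * cs.simple i)) i := by
      intro hcon
      obtain ⟨x', hl, hx'⟩ := hZ.exists_mul_eq (by rwa [simple_mul_simple_cancel_right]) hcon
      have hx : x' = m * (b * (b * cs.simple i)⁻¹) := by
        rw [← mul_assoc, eq_mul_inv_iff_mul_eq, ← hx']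
        simp [mul_assoc]
      exact (hm _ (mul_mem hb (inv_mem hmem))).not_gt (hx ▸ hl)
    rw [cs.not_isRightDescent_iff] at hnd
    simp only [mul_assoc, simple_mul_simple_self, mul_one] at hnd
    omega

end HasBruhatLifting

end Parabolic

end CoxeterSystem

/-- Let `J, J' ⊆ S` and `x ∈ W`. Then `w₀^{J'} ▷ (x ◁ w₀^J)` is the unique
element of minimal length in the double coset `W_{J'} x W_J`, and
`w₀^{J'} ∗ (x ∗ w₀^J)` is the unique element of maximal length in it. -/
theorem double_coset_min_max {B W : Type*} [Group W] [Finite W] {M : CoxeterMatrix B}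
    (cs : CoxeterSystem M W) (star rtr ltr : W → W → W)
    (hstar : ∀ x y : W, star x y ∈ cs.lset x y ∧
      ∀ z ∈ cs.lset x y, cs.bruhatLE z (star x y))
    (hrtr : ∀ x y : W, rtr x y ∈ cs.lset x y ∧
      ∀ z ∈ cs.lset x y, cs.bruhatLE (rtr x y) z)
    (hltr : ∀ x y : W, ltr x y ∈ cs.rset x y ∧
      ∀ z ∈ cs.rset x y, cs.bruhatLE (ltr x y) z)
    (J J' : Set W) (hJ : J ⊆ Set.range cs.simple) (hJ' : J' ⊆ Set.range cs.simple)
    (w₀J w₀J' : W)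
    (hw₀J : w₀J ∈ Subgroup.closure J ∧
      ∀ w ∈ Subgroup.closure J, cs.length w ≤ cs.length w₀J)
    (hw₀J' : w₀J' ∈ Subgroup.closure J' ∧
      ∀ w ∈ Subgroup.closure J', cs.length w ≤ cs.length w₀J')
    (x : W) :
    (rtr w₀J' (ltr x w₀J) ∈
        {w : W | ∃ a ∈ Subgroup.closure J', ∃ b ∈ Subgroup.closure J, w = a * x * b} ∧
      (∀ w ∈ {w : W | ∃ a ∈ Subgroup.closure J', ∃ b ∈ Subgroup.closure J, w = a * x * b},
        cs.length (rtr w₀J' (ltr x w₀J)) ≤ cs.length w) ∧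
      (∀ w ∈ {w : W | ∃ a ∈ Subgroup.closure J', ∃ b ∈ Subgroup.closure J, w = a * x * b},
        cs.length w = cs.length (rtr w₀J' (ltr x w₀J)) → w = rtr w₀J' (ltr x w₀J))) ∧
    (star w₀J' (star x w₀J) ∈
        {w : W | ∃ a ∈ Subgroup.closure J', ∃ b ∈ Subgroup.closure J, w = a * x * b} ∧
      (∀ w ∈ {w : W | ∃ a ∈ Subgroup.closure J', ∃ b ∈ Subgroup.closure J, w = a * x * b},
        cs.length w ≤ cs.length (star w₀J' (star x w₀J))) ∧
      (∀ w ∈ {w : W | ∃ a ∈ Subgroup.closure J', ∃ b ∈ Subgroup.closure J, w = a * x * b},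
        cs.length w = cs.length (star w₀J' (star x w₀J)) → w = star w₀J' (star x w₀J))) := by
  have hZ : cs.HasBruhatLifting := CoxeterSystem.hasBruhatLifting_of_isGreatest
    fun x i ↦ ⟨_, (hstar x (cs.simple i)).1, (hstar x (cs.simple i)).2⟩
  obtain ⟨⟨b₀, hb₀, hm⟩, hmle⟩ := hltr x w₀J
  obtain ⟨⟨a₀, ha₀, hn⟩, hnle⟩ := hrtr w₀J' (ltr x w₀J)
  obtain ⟨⟨u₀, hu₀, hy⟩, hyle⟩ := hstar x w₀J
  obtain ⟨⟨a₁, ha₁, hz⟩, hzle⟩ := hstar w₀J' (star x w₀J)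
  set m := ltr x w₀J
  set n := rtr w₀J' m
  set y := star x w₀J
  set z := star w₀J' y
  rw [hZ.bruhatLE_longest_iff hJ hw₀J] at hb₀
  rw [hZ.bruhatLE_longest_iff hJ' hw₀J'] at ha₀ ha₁
  have hm_le : ∀ b ∈ Subgroup.closure J, cs.bruhatLE m (x * b) := fun b hb ↦
    hmle _ ⟨b, (hZ.bruhatLE_longest_iff hJ hw₀J).2 hb, rfl⟩
  have hn_le : ∀ a ∈ Subgroup.closure J', cs.bruhatLE n (a * m) := fun a ha ↦
    hnle _ ⟨a, (hZ.bruhatLE_longest_iff hJ' hw₀J').2 ha, rfl⟩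
  have hz_le : ∀ a ∈ Subgroup.closure J', cs.bruhatLE (a * y) z := fun a ha ↦
    hzle _ ⟨a, (hZ.bruhatLE_longest_iff hJ' hw₀J').2 ha, rfl⟩
  have hadd : ∀ b ∈ Subgroup.closure J, cs.length (m * b) = cs.length m + cs.length b := by
    refine fun b hb ↦ hZ.length_mul_of_forall_length_le hJ (fun c hc ↦ ?_) hb
    rw [hm, mul_assoc, ← hm]
    exact (hm_le _ (mul_mem hb₀ hc)).length_le
  have hdesc : ∀ i, cs.simple i ∈ J → cs.IsRightDescent (m * w₀J) i := fun i hi ↦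
    CoxeterSystem.isRightDescent_of_forall_length_le (fun b hb ↦ by
      rw [mul_assoc, hadd _ (mul_mem hw₀J.1 hb), hadd _ hw₀J.1]
      exact Nat.add_le_add_left (hw₀J.2 _ (mul_mem hw₀J.1 hb)) _) hi
  have hcoset : ∀ b ∈ Subgroup.closure J, cs.bruhatLE (x * b) (m * w₀J) := by
    intro b hb
    have h := hZ.mul_bruhatLE hJ hdesc (cs.bruhatLE_refl _)
      (mul_mem (inv_mem hw₀J.1) (mul_mem (inv_mem hb₀) hb))
    rw [hm] at h ⊢
    simpa [mul_assoc] using h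
  have hx : cs.bruhatLE x (m * w₀J) := by simpa using hcoset 1 (one_mem _)
  have hyw : y = m * w₀J := by
    refine CoxeterSystem.bruhatLE.antisymm (cs := cs) ?_ ?_
    · rw [hy]
      exact hZ.mul_bruhatLE hJ hdesc (hu₀.trans hx) hw₀J.1
    · exact hyle _ ⟨m, by simpa using hm_le 1 (one_mem _), rfl⟩
  have hmin : ∀ a ∈ Subgroup.closure J', ∀ b ∈ Subgroup.closure J,
      cs.bruhatLE n (a * x * b) := by
    intro a ha b hb
    rw [mul_assoc]
    refine hZ.bruhatLE_mul_left hJ' (fun i hi ↦ ?_) ?_ ha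
    · have h := hn_le _ (mul_mem (Subgroup.subset_closure hi) ha₀)
      rw [mul_assoc, ← hn] at h
      exact h.length_le.lt_of_ne (cs.length_simple_mul_ne n i).symm
    · exact CoxeterSystem.bruhatLE.trans (by simpa using hn_le 1 (one_mem _)) (hm_le b hb)
  have hmax : ∀ a ∈ Subgroup.closure J', ∀ b ∈ Subgroup.closure J,
      cs.bruhatLE (a * x * b) z := by
    intro a ha b hb
    rw [mul_assoc]
    refine hZ.mul_left_bruhatLE hJ' (fun i hi ↦ ?_) ?_ ha
    · have h := hz_le _ (mul_mem (Subgroup.subset_closure hi) ha₁)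
      rw [mul_assoc, ← hz] at h
      exact h.length_le.lt_of_ne (cs.length_simple_mul_ne z i)
    · exact (hyw ▸ hcoset b hb).trans (by simpa using hz_le 1 (one_mem _))
  refine ⟨⟨⟨a₀, ha₀, b₀, hb₀, ?_⟩, ?_, ?_⟩, ⟨⟨a₁, ha₁, b₀ * w₀J, mul_mem hb₀ hw₀J.1, ?_⟩, ?_, ?_⟩⟩
  · rw [hn, hm, mul_assoc]
  · rintro _ ⟨a, ha, b, hb, rfl⟩
    exact (hmin a ha b hb).length_le
  · rintro _ ⟨a, ha, b, hb, rfl⟩ h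
    exact ((hmin a ha b hb).eq_of_length_le h.le).symm
  · rw [hz, hyw, hm]
    simp only [mul_assoc]
  · rintro _ ⟨a, ha, b, hb, rfl⟩
    exact (hmax a ha b hb).length_le
  · rintro _ ⟨a, ha, b, hb, rfl⟩ h
    exact (hmax a ha b hb).eq_of_length_le h.ge
end

section
/- Let J ⊆ S and x, y ∈ W. Then x ≤ max(y W_J) in Bruhat order if and only if min(x W_J) ≤ y in Bruhat order. -/
namespace CoxeterSystem

variable {B W : Type*} [Group W] {M : CoxeterMatrix B} (cs : CoxeterSystem M W)

open Classical in
/-- The action of a simple reflection `s i` on pairs consisting of a group element and a parity: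
the group element is conjugated and the parity changes exactly at `s i`. -/
noncomputable def parityStep (i : B) : Function.End (W × ZMod 2) :=
  fun p => (cs.simple i * p.1 * cs.simple i, p.2 + if p.1 = cs.simple i then 1 else 0)

open Classical in
theorem parityStep_mul_pow_apply (i j : B) (m : ℕ) (p : W × ZMod 2) :
    ((cs.parityStep i * cs.parityStep j) ^ m) p =
      ((cs.simple i * cs.simple j) ^ m * p.1 * ((cs.simple i * cs.simple j) ^ m)⁻¹,
        p.2 + ∑ k ∈ Finset.range (2 * m),
          if p.1 = ((cs.simple i * cs.simple j) ^ k)⁻¹ * cs.simple j then 1 else 0) := by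
  induction m with
  | zero => simp [show (1 : Function.End (W × ZMod 2)) p = p from rfl]
  | succ m ih =>
    have hflip : ∀ k : ℕ, cs.simple j * (cs.simple i * cs.simple j) ^ k =
        ((cs.simple i * cs.simple j) ^ k)⁻¹ * cs.simple j := by
      intro k
      induction k with
      | zero => simp
      | succ k ih =>
        rw [pow_succ, ← mul_assoc, ih, ← pow_succ, pow_succ']
        simp [mul_assoc]
    rw [pow_succ']
    change cs.parityStep i (cs.parityStep j (((cs.parityStep i * cs.parityStep j) ^ m) p)) = _
    rw [ih]
    set c := cs.simple i * cs.simple j with hc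
    have hcinv : c⁻¹ = cs.simple j * cs.simple i := by simp [hc]
    have h₁ : c ^ m * p.1 * (c ^ m)⁻¹ = cs.simple j ↔
        p.1 = (c ^ (2 * m))⁻¹ * cs.simple j := by
      rw [two_mul, pow_add, mul_inv_rev, mul_assoc _ _ (cs.simple j), ← hflip m,
        mul_inv_eq_iff_eq_mul, eq_inv_mul_iff_mul_eq]
    have h₂ : cs.simple j * (c ^ m * p.1 * (c ^ m)⁻¹) * cs.simple j = cs.simple i ↔
        p.1 = (c ^ (2 * m + 1))⁻¹ * cs.simple j := by
      have e : (c ^ (2 * m + 1))⁻¹ * cs.simple j =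
          (c ^ m)⁻¹ * (cs.simple j * cs.simple i * cs.simple j) * c ^ m := by
        rw [mul_assoc _ _ (c ^ m), mul_assoc _ (cs.simple j) (c ^ m), hflip m, ← hcinv]
        rw [show 2 * m + 1 = m + 1 + m by ring, pow_add, pow_succ]
        group
      rw [e]
      constructor
      · intro h
        rw [← h]
        simp [mul_assoc]
      · intro h
        rw [h]
        simp [mul_assoc]
    rw [show 2 * (m + 1) = 2 * m + 1 + 1 by ring, Finset.sum_range_succ, Finset.sum_range_succ]
    simp only [parityStep, h₁, h₂]
    refine Prod.ext ?_ ?_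
    · simp [pow_succ', hc, mul_assoc]
    · simp only [add_assoc]

theorem isLiftable_parityStep : M.IsLiftable cs.parityStep := by
  classical
  intro i j
  funext p
  rw [parityStep_mul_pow_apply, simple_mul_simple_pow, two_mul, Finset.sum_range_add]
  simp only [pow_add, simple_mul_simple_pow, one_mul, CharTwo.add_self_eq_zero]
  simp [show (1 : Function.End (W × ZMod 2)) p = p from rfl]

/-- The action of the Coxeter group on pairs consisting of a group element and a parity. -/
noncomputable def parityHom : W →* Function.End (W × ZMod 2) :=
  cs.lift ⟨cs.parityStep, cs.isLiftable_parityStep⟩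

/-- The parity of the number of occurrences of `t` in the right inversion sequence of a word
representing `w`. -/
noncomputable def inversionParity (w t : W) : ZMod 2 := (cs.parityHom w (t, 0)).2

theorem parityHom_one_apply (p : W × ZMod 2) : cs.parityHom 1 p = p := by
  rw [map_one]
  rfl

theorem parityHom_mul_apply (v w : W) (p : W × ZMod 2) :
    cs.parityHom (v * w) p = cs.parityHom v (cs.parityHom w p) := by
  rw [map_mul]
  rfl

open Classical in
theorem parityHom_simple_apply (i : B) (p : W × ZMod 2) :
    cs.parityHom (cs.simple i) p =
      (cs.simple i * p.1 * cs.simple i, p.2 + if p.1 = cs.simple i then 1 else 0) := by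
  rw [parityHom, lift_apply_simple]
  rfl

open Classical in
theorem inversionParity_simple (i : B) (t : W) :
    cs.inversionParity (cs.simple i) t = if t = cs.simple i then 1 else 0 := by
  simp [inversionParity, parityHom_simple_apply]

theorem parityHom_apply (w t : W) (a : ZMod 2) :
    cs.parityHom w (t, a) = (w * t * w⁻¹, a + cs.inversionParity w t) := by
  induction w using cs.simple_induction_left generalizing t a with
  | one => simp [inversionParity, parityHom_one_apply]
  | mul_simple_left w i ih =>
    rw [inversionParity, parityHom_mul_apply, parityHom_mul_apply, ih, ih, parityHom_simple_apply,
      parityHom_simple_apply]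
    simp [mul_assoc, add_assoc]

theorem inversionParity_mul (v w t : W) :
    cs.inversionParity (v * w) t =
      cs.inversionParity w t + cs.inversionParity v (w * t * w⁻¹) := by
  rw [inversionParity, parityHom_mul_apply, parityHom_apply, parityHom_apply, zero_add]

theorem inversionParity_one (t : W) : cs.inversionParity 1 t = 0 := by
  simp [inversionParity, parityHom_one_apply]

variable {cs} in
theorem IsReflection.inversionParity_self {t : W} (ht : cs.IsReflection t) :
    cs.inversionParity t t = 1 := by
  obtain ⟨w, i, rfl⟩ := ht
  have h := cs.inversionParity_mul w w⁻¹ (w * cs.simple i * w⁻¹)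
  rw [mul_inv_cancel, inversionParity_one] at h
  have e : w⁻¹ * (w * cs.simple i * w⁻¹) * w⁻¹⁻¹ = cs.simple i := by group
  rw [e] at h
  rw [inversionParity_mul, e, inversionParity_mul, inversionParity_simple, if_pos rfl,
    mul_inv_cancel_right]
  linear_combination -h

theorem length_mul_lt_of_inversionParity_ne_zero {w t : W} (h : cs.inversionParity w t ≠ 0) :
    cs.length (w * t) < cs.length w := by
  classical
  induction hn : cs.length w using Nat.strong_induction_on generalizing w with
  | _ n ih =>
    subst hn
    by_cases hw : w = 1
    · exact absurd (by rw [hw, inversionParity_one]) h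
    obtain ⟨i, hi⟩ := cs.exists_leftDescent_of_ne_one hw
    obtain ⟨v, rfl⟩ : ∃ v, w = cs.simple i * v := ⟨cs.simple i * w, by simp⟩
    simp only [IsLeftDescent, simple_mul_simple_cancel_left] at hi
    rw [inversionParity_mul, inversionParity_simple] at h
    by_cases hv : cs.inversionParity v t = 0
    · have hs : v * t * v⁻¹ = cs.simple i := by
        by_contra hne
        simp [hv, hne] at h
      rw [mul_inv_eq_iff_eq_mul] at hs
      rwa [mul_assoc, hs, simple_mul_simple_cancel_left]
    · have := ih _ hi hv rfl
      have := cs.length_mul_le (cs.simple i) (v * t)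
      rw [length_simple] at this
      rw [mul_assoc]
      omega

variable {cs} in
/-- The inversion parity detects right inversions. -/
theorem IsReflection.length_mul_lt_iff {t : W} (ht : cs.IsReflection t) (w : W) :
    cs.length (w * t) < cs.length w ↔ cs.inversionParity w t ≠ 0 := by
  refine ⟨fun h h0 => ?_, cs.length_mul_lt_of_inversionParity_ne_zero⟩
  have h1 : cs.inversionParity (w * t) t ≠ 0 := by
    rw [inversionParity_mul, ht.inversionParity_self, mul_inv_cancel_right, h0]
    simp
  have := cs.length_mul_lt_of_inversionParity_ne_zero h1
  rw [mul_assoc, ht.mul_self, mul_one] at this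
  omega

variable {cs} in
theorem IsReflection.length_mul_simple_lt {t : W} (ht : cs.IsReflection t) {i : B}
    (hti : t ≠ cs.simple i) {u : W} (h : cs.length u < cs.length (u * t)) :
    cs.length (u * cs.simple i) < cs.length (u * t * cs.simple i) := by
  classical
  have ht' : cs.IsReflection (cs.simple i * t * cs.simple i) := by
    simpa using ht.conj (cs.simple i)
  have e : u * t * cs.simple i = u * cs.simple i * (cs.simple i * t * cs.simple i) := by
    simp [mul_assoc]
  rw [e]
  refine lt_of_le_of_ne (not_lt.1 ?_) (ht'.length_mul_left_ne _).symm
  rw [ht'.length_mul_lt_iff, not_not, inversionParity_mul, inversionParity_simple]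
  have h0 : cs.inversionParity u t = 0 := by
    by_contra hne
    exact absurd ((ht.length_mul_lt_iff u).2 hne) (by omega)
  have hne : cs.simple i * t * cs.simple i ≠ cs.simple i := by
    intro hh
    apply hti
    rwa [mul_eq_right, mul_eq_one_iff_inv_eq, inv_simple, eq_comm] at hh
  rw [if_neg hne, zero_add, inv_simple]
  simpa [mul_assoc] using h0

variable {cs} {u v w : W} {i : B} {J : Set W}

theorem bruhatLE.mul_simple_le (h : cs.bruhatLE u v) (hv : cs.IsRightDescent v i) :
    cs.bruhatLE (u * cs.simple i) v := by
  induction h using Relation.ReflTransGen.head_induction_on with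
  | refl => exact .single ⟨_, cs.isReflection_simple i, by simp, hv⟩
  | head h₁ h₂ ih =>
    obtain ⟨t, ht, rfl, hlt⟩ := h₁
    by_cases hti : t = cs.simple i
    · rwa [← hti]
    · refine ih.head ⟨cs.simple i * t * cs.simple i, ?_, by simp [mul_assoc],
        ht.length_mul_simple_lt hti hlt⟩
      simpa using ht.conj (cs.simple i)

theorem bruhatLE.le_mul_simple (h : cs.bruhatLE u v) (hu : ¬cs.IsRightDescent u i) :
    cs.bruhatLE u (v * cs.simple i) := by
  induction h with
  | refl =>
    rw [not_isRightDescent_iff] at hu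
    exact .single ⟨_, cs.isReflection_simple i, rfl, by omega⟩
  | tail h₁ h₂ ih =>
    obtain ⟨t, ht, rfl, hlt⟩ := h₂
    by_cases hti : t = cs.simple i
    · rwa [hti, simple_mul_simple_cancel_right]
    · refine ih.tail ⟨cs.simple i * t * cs.simple i, ?_, by simp [mul_assoc],
        ht.length_mul_simple_lt hti hlt⟩
      simpa using ht.conj (cs.simple i)

theorem bruhatLE_mul_left_iff (hJ : J ⊆ Set.range cs.simple)
    (hv : ∀ i, cs.simple i ∈ J → cs.IsRightDescent v i) {a : W} (ha : a ∈ Subgroup.closure J) :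
    cs.bruhatLE (u * a) v ↔ cs.bruhatLE u v := by
  induction ha using Subgroup.closure_induction generalizing u with
  | mem x hx =>
    obtain ⟨i, rfl⟩ := hJ hx
    exact ⟨fun h => by simpa using h.mul_simple_le (hv i hx), fun h => h.mul_simple_le (hv i hx)⟩
  | one => simp
  | mul x y _ _ hx hy => rw [← mul_assoc, hy, hx]
  | inv x _ hx => rw [← hx, inv_mul_cancel_right]

theorem bruhatLE_mul_right_iff (hJ : J ⊆ Set.range cs.simple)
    (hu : ∀ i, cs.simple i ∈ J → ¬cs.IsRightDescent u i) {a : W} (ha : a ∈ Subgroup.closure J) :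
    cs.bruhatLE u (v * a) ↔ cs.bruhatLE u v := by
  induction ha using Subgroup.closure_induction generalizing v with
  | mem x hx =>
    obtain ⟨i, rfl⟩ := hJ hx
    exact ⟨fun h => by simpa using h.le_mul_simple (hu i hx), fun h => h.le_mul_simple (hu i hx)⟩
  | one => simp
  | mul x y _ _ hx hy => rw [← mul_assoc, hy, hx]
  | inv x _ hx => rw [← hx, inv_mul_cancel_right]

end CoxeterSystem

/-- Let `J ⊆ S` and `x, y ∈ W`. Then `x ≤ max(y W_J)` in Bruhat order iff
`min(x W_J) ≤ y` in Bruhat order. -/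
theorem le_coset_max_iff_coset_min_le {B W : Type*} [Group W] [Finite W] {M : CoxeterMatrix B}
    (cs : CoxeterSystem M W)
    (J : Set W) (hJ : J ⊆ Set.range cs.simple) (x y : W)
    (maxyWJ : W)
    (hmax : maxyWJ ∈ {w : W | ∃ a ∈ Subgroup.closure J, w = y * a} ∧
      ∀ w ∈ {w : W | ∃ a ∈ Subgroup.closure J, w = y * a},
        cs.length w ≤ cs.length maxyWJ)
    (minxWJ : W)
    (hmin : minxWJ ∈ {w : W | ∃ a ∈ Subgroup.closure J, w = x * a} ∧
      ∀ w ∈ {w : W | ∃ a ∈ Subgroup.closure J, w = x * a},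
        cs.length minxWJ ≤ cs.length w) :
    cs.bruhatLE x maxyWJ ↔ cs.bruhatLE minxWJ y := by
  obtain ⟨⟨a, ha, rfl⟩, hmax⟩ := hmax
  obtain ⟨⟨b, hb, rfl⟩, hmin⟩ := hmin
  have hdesc : ∀ i, cs.simple i ∈ J → cs.IsRightDescent (y * a) i := fun i hi =>
    lt_of_le_of_ne
      (hmax _ ⟨a * cs.simple i, mul_mem ha (Subgroup.subset_closure hi), mul_assoc _ _ _⟩)
      (cs.length_mul_simple_ne _ i)
  have hasc : ∀ i, cs.simple i ∈ J → ¬cs.IsRightDescent (x * b) i := fun i hi =>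
    not_lt.2
      (hmin _ ⟨b * cs.simple i, mul_mem hb (Subgroup.subset_closure hi), mul_assoc _ _ _⟩)
  rw [← CoxeterSystem.bruhatLE_mul_left_iff hJ hdesc hb,
    CoxeterSystem.bruhatLE_mul_right_iff hJ hasc ha]
end

section
/- Let Y be a topological space and let l be a natural number such that every irreducible component of Y has dimension at least l. Suppose Y is the disjoint union of a finite family (Y_k)_{k ∈ K} of nonempty irreducible locally closed subsets such that for each k the closure of Y_k in Y has dimension at most l. Then the irreducible components of Y are precisely the closures (in Y) of those Y_k whose closure has dimension exactly l, and these closures are pairwise distinct. -/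
open TopologicalSpace in
/-- A closed set properly contained in an irreducible set has strictly smaller dimension. -/
theorem topologicalKrullDim_add_one_le_of_isClosed_of_ssubset {X : Type*} [TopologicalSpace X]
    {A B : Set X} (hA : IsClosed A) (hB : IsIrreducible B) (h : A ⊂ B) :
    topologicalKrullDim A + 1 ≤ topologicalKrullDim B := by
  have : IrreducibleSpace B := Subtype.irreducibleSpace hB
  let top : IrreducibleCloseds B := ⟨Set.univ, IrreducibleSpace.isIrreducible_univ B, isClosed_univ⟩
  have hi : Topology.IsInducing (Set.inclusion h.subset) :=
    (Topology.IsEmbedding.inclusion _).isInducing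
  have hlt (c : IrreducibleCloseds A) : IrreducibleCloseds.map _ hi.continuous c < top := by
    obtain ⟨x, hxB, hxA⟩ := Set.exists_of_ssubset h
    have hsub : closure (Set.inclusion h.subset '' (c : Set A)) ⊆ Subtype.val ⁻¹' A :=
      closure_minimal (Set.image_subset_iff.2 fun y _ ↦ y.2) (hA.preimage continuous_subtype_val)
    exact SetLike.coe_ssubset_coe.1 <| Set.ssubset_univ_iff.2 fun heq ↦
      hxA (hsub (heq.symm ▸ Set.mem_univ (⟨x, hxB⟩ : B)))
  cases isEmpty_or_nonempty (IrreducibleCloseds A)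
  · simp [topologicalKrullDim, Order.krullDim_eq_bot]
  · rw [topologicalKrullDim, topologicalKrullDim, ← Order.krullDim_WithTop]
    exact Order.krullDim_le_of_strictMono
      (WithTop.recTopCoe (C := fun _ ↦ IrreducibleCloseds B) top
        (IrreducibleCloseds.map _ hi.continuous))
      (WithTop.strictMono_iff.2 ⟨IrreducibleCloseds.map_strictMono_of_isInducing hi, hlt⟩)

/-- Two nonempty locally closed sets with the same irreducible closure intersect. -/
theorem IsLocallyClosed.inter_nonempty_of_closure_eq {X : Type*} [TopologicalSpace X] {s t : Set X}
    (hs : IsLocallyClosed s) (ht : IsLocallyClosed t) (hirr : IsIrreducible s)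
    (hne : t.Nonempty) (h : closure s = closure t) : (s ∩ t).Nonempty := by
  obtain ⟨x, hx, hxs, hxt⟩ := hirr.closure.isPreirreducible _ _ hs.isOpen_coborder
    ht.isOpen_coborder
    (hirr.nonempty.mono fun x hx ↦ ⟨subset_closure hx, subset_coborder hx⟩)
    (hne.mono fun x hx ↦ ⟨h ▸ subset_closure hx, subset_coborder hx⟩)
  exact ⟨x, closure_inter_coborder.subset ⟨hx, hxs⟩, closure_inter_coborder.subset ⟨h ▸ hx, hxt⟩⟩

/-- If finitely many irreducible sets cover a space, then every irreducible component is the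
closure of one of them. -/
theorem exists_eq_closure_of_mem_irreducibleComponents {X ι : Type*} [TopologicalSpace X] [Finite ι]
    {s : ι → Set X} (hirr : ∀ i, IsIrreducible (s i)) (hcover : ⋃ i, s i = Set.univ)
    {C : Set X} (hC : C ∈ irreducibleComponents X) : ∃ i, closure (s i) = C := by
  have hfin : (Set.range fun i ↦ closure (s i)).Finite := Set.finite_range _
  obtain ⟨z, hz, hCz⟩ := isIrreducible_iff_sUnion_isClosed.1 hC.1 hfin.toFinset (by simp) (by
    rw [hfin.coe_toFinset, Set.sUnion_range]
    exact (Set.subset_univ C).trans <| hcover ▸ Set.iUnion_mono fun i ↦ subset_closure)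
  obtain ⟨i, rfl⟩ := hfin.mem_toFinset.1 hz
  exact ⟨i, (hC.2 (hirr i).closure hCz).antisymm hCz⟩

/-- Let `Y` be a topological space and `l : ℕ` such that every irreducible
component of `Y` has (topological Krull) dimension at least `l`. Suppose `Y` is
the disjoint union of a finite family `(Yk k)` of nonempty irreducible locally
closed subsets whose closures have dimension at most `l`. Then the irreducible
components of `Y` are precisely the closures of those `Yk k` whose closure has
dimension exactly `l`, and these closures are pairwise distinct. -/
theorem irreducibleComponents_of_partition
    {Y : Type*} [TopologicalSpace Y] (l : ℕ)
    {K : Type*} [Finite K] (Yk : K → Set Y)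
    (hcover : ∀ y : Y, ∃! k : K, y ∈ Yk k)
    (hne : ∀ k : K, (Yk k).Nonempty)
    (hirr : ∀ k : K, IsIrreducible (Yk k))
    (hlc : ∀ k : K, IsLocallyClosed (Yk k))
    (hcomp : ∀ C ∈ irreducibleComponents Y, (l : WithBot ℕ∞) ≤ topologicalKrullDim ↥C)
    (hdim : ∀ k : K, topologicalKrullDim ↥(closure (Yk k)) ≤ (l : WithBot ℕ∞)) :
    irreducibleComponents Y =
      (fun k => closure (Yk k)) ''
        {k : K | topologicalKrullDim ↥(closure (Yk k)) = (l : WithBot ℕ∞)} ∧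
    Set.InjOn (fun k => closure (Yk k))
      {k : K | topologicalKrullDim ↥(closure (Yk k)) = (l : WithBot ℕ∞)} := by
  have hU : ⋃ k, Yk k = Set.univ := Set.iUnion_eq_univ_iff.2 fun y ↦ (hcover y).exists
  refine ⟨Set.Subset.antisymm (fun C hC ↦ ?_) ?_, fun i _ j _ hij ↦ ?_⟩
  · obtain ⟨k, rfl⟩ := exists_eq_closure_of_mem_irreducibleComponents hirr hU hC
    exact ⟨k, (hdim k).antisymm (hcomp _ hC), rfl⟩
  · rintro _ ⟨k, hk, rfl⟩
    obtain ⟨C, hC, hkC⟩ :=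
      exists_mem_irreducibleComponents_subset_of_isIrreducible _ (hirr k).closure
    obtain ⟨j, rfl⟩ := exists_eq_closure_of_mem_irreducibleComponents hirr hU hC
    obtain heq | hlt := hkC.eq_or_ssubset
    · exact Set.mem_of_eq_of_mem heq hC
    · have hle := (topologicalKrullDim_add_one_le_of_isClosed_of_ssubset isClosed_closure
        (hirr j).closure hlt).trans (hdim j)
      rw [show topologicalKrullDim ↥(closure (Yk k)) = l from hk] at hle
      exact absurd (by exact_mod_cast hle : l + 1 ≤ l) (Nat.not_succ_le_self l)
  · obtain ⟨y, hi, hj⟩ :=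
      (hlc i).inter_nonempty_of_closure_eq (hlc j) (hirr i) (hne j) hij
    exact (hcover y).unique hi hj
end

section
/- Let Z be an irreducible topological space of finite dimension d, and let Z = ⊔_{i ∈ I} X_i = ⊔_{j ∈ J} Y_j be two finite partitions of Z into nonempty irreducible locally closed subsets such that for each i the closure of X_i is a union of some of the X_{i'}, and for each j the closure of Y_j is a union of some of the Y_{j'}. Assume that: (a) whenever X_i ∩ Y_j ≠ ∅, the intersection X_i ∩ Y_j is irreducible of dimension dim X_i + dim Y_j − d (as holds when Z is a smooth variety and all nonempty intersections X_i ∩ Y_j are transversal); and (b) for all i, j, every irreducible component of (closure of X_i) ∩ (closure of Y_j) has dimension at least dim X_i + dim Y_j − d. Then for every i ∈ I and j ∈ J: X_i ∩ Y_j ≠ ∅ if and only if (closure of X_i) ∩ (closure of Y_j) ≠ ∅, and in this case the closure of X_i ∩ Y_j equals (closure of X_i) ∩ (closure of Y_j). In particular, Z is the disjoint union of the nonempty intersections X_i ∩ Y_j. -/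
open Set Order TopologicalSpace Topology in
/-- A subspace that is not dense in an irreducible space has strictly smaller dimension. -/
theorem Topology.IsInducing.topologicalKrullDim_add_one_le {S T : Type*} [TopologicalSpace S]
    [TopologicalSpace T] [IrreducibleSpace T] {f : S → T} (hf : IsInducing f)
    (hd : ¬ DenseRange f) : topologicalKrullDim S + 1 ≤ topologicalKrullDim T := by
  unfold topologicalKrullDim
  rcases isEmpty_or_nonempty (IrreducibleCloseds S) with h | h
  · simp [krullDim_eq_bot]
  rw [← krullDim_WithTop]
  let t : IrreducibleCloseds T := ⟨univ, IrreducibleSpace.isIrreducible_univ T, isClosed_univ⟩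
  let g : WithTop (IrreducibleCloseds S) → IrreducibleCloseds T :=
    WithTop.recTopCoe t (IrreducibleCloseds.map f hf.continuous)
  refine krullDim_le_of_strictMono g <|
    WithTop.strictMono_iff.2 ⟨IrreducibleCloseds.map_strictMono_of_isInducing hf, fun x ↦ ?_⟩
  refine lt_of_le_of_ne (fun _ _ ↦ mem_univ _) fun h ↦ hd ?_
  have hx : closure (f '' (x : Set S)) = univ := congrArg SetLike.coe h
  exact dense_iff_closure_eq.2 <| univ_subset_iff.1 <|
    hx.symm.subset.trans (closure_mono (image_subset_range _ _))

theorem topologicalKrullDim_mono {T : Type*} [TopologicalSpace T] {A B : Set T} (h : A ⊆ B) :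
    topologicalKrullDim A ≤ topologicalKrullDim B :=
  (Topology.IsEmbedding.inclusion h).isInducing.topologicalKrullDim_le

theorem topologicalKrullDim_add_one_le_of_ssubset {T : Type*} [TopologicalSpace T] {A B : Set T}
    (hA : IsClosed A) (hB : IsIrreducible B) (h : A ⊂ B) :
    topologicalKrullDim A + 1 ≤ topologicalKrullDim B := by
  have : IrreducibleSpace B := Subtype.irreducibleSpace hB
  refine (Topology.IsEmbedding.inclusion h.subset).isInducing.topologicalKrullDim_add_one_le fun hd ↦ ?_
  have hc : IsClosed (Set.range (Set.inclusion h.subset)) := by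
    rw [Set.range_inclusion]
    exact hA.preimage continuous_subtype_val
  refine h.not_subset fun b hb ↦ ?_
  obtain ⟨a, ha⟩ := Set.range_eq_univ.1 (hc.closure_eq.symm.trans hd.closure_eq) ⟨b, hb⟩
  have hab : (a : T) = b := congrArg Subtype.val ha
  exact hab ▸ a.2

/-- A locally closed set meets every set having the same nonempty closure. -/
theorem IsLocallyClosed.inter_nonempty_of_closure_eq_s17 {T : Type*} [TopologicalSpace T]
    {A B : Set T} (hA : IsLocallyClosed A) (hne : A.Nonempty) (h : closure A = closure B) :
    (A ∩ B).Nonempty := by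
  obtain ⟨U, F, hU, hF, rfl⟩ := hA
  obtain ⟨x, hx⟩ := hne
  obtain ⟨y, hyU, hyB⟩ := mem_closure_iff.1 (h ▸ subset_closure hx) U hU hx.1
  refine ⟨y, ⟨hyU, ?_⟩, hyB⟩
  exact hF.closure_subset_iff.2 Set.inter_subset_right (h ▸ subset_closure hyB)

theorem IsIrreducible.exists_subset_of_subset_iUnion {T ι : Type*} [TopologicalSpace T] [Finite ι]
    {A : Set T} (hA : IsIrreducible A) {F : ι → Set T} (hF : ∀ i, IsClosed (F i))
    (h : A ⊆ ⋃ i, F i) : ∃ i, A ⊆ F i := by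
  obtain ⟨z, hz, hAz⟩ := isIrreducible_iff_sUnion_isClosed.1 hA (Set.finite_range F).toFinset
    (by simpa using hF) (by simpa using h)
  obtain ⟨i, rfl⟩ := (Set.finite_range F).mem_toFinset.1 hz
  exact ⟨i, hAz⟩

theorem exists_natCast_eq_topologicalKrullDim {T : Type*} [TopologicalSpace T] {d : ℕ}
    (hd : topologicalKrullDim T ≤ (d : WithBot ℕ∞)) {A : Set T} (hA : IsIrreducible A) :
    ∃ n : ℕ, topologicalKrullDim A = (n : WithBot ℕ∞) := by
  have : IrreducibleSpace A := Subtype.irreducibleSpace hA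
  have : Nonempty (TopologicalSpace.IrreducibleCloseds A) :=
    ⟨⟨Set.univ, IrreducibleSpace.isIrreducible_univ A, isClosed_univ⟩⟩
  have h0 : topologicalKrullDim A ≠ ⊥ := Order.krullDim_ne_bot_iff.2 this
  have h1 := (topologicalKrullDim_subspace_le T A).trans hd
  lift topologicalKrullDim A to ℕ∞ using h0 with n
  have h2 : n ≤ (d : ℕ∞) := by exact_mod_cast h1
  lift n to ℕ using ne_top_of_le_ne_top (ENat.natCast_ne_top d) h2
  exact ⟨n, rfl⟩

/-- If closed subsets of two irreducible closed sets have at least the same total dimension, then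
they are equal to them. -/
theorem eq_and_eq_of_topologicalKrullDim_add_le {T : Type*} [TopologicalSpace T] {d : ℕ}
    (hd : topologicalKrullDim T ≤ (d : WithBot ℕ∞)) {A A' B B' : Set T}
    (hA : IsIrreducible A) (hA' : IsIrreducible A') (hB : IsIrreducible B)
    (hB' : IsIrreducible B') (hcA : IsClosed A') (hcB : IsClosed B') (hAA : A' ⊆ A) (hBB : B' ⊆ B)
    (h : topologicalKrullDim A + topologicalKrullDim B ≤
      topologicalKrullDim A' + topologicalKrullDim B') : A' = A ∧ B' = B := by
  have hsA := topologicalKrullDim_add_one_le_of_ssubset hcA hA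
  have hsB := topologicalKrullDim_add_one_le_of_ssubset hcB hB
  have hmA := topologicalKrullDim_mono hAA
  have hmB := topologicalKrullDim_mono hBB
  obtain ⟨a, ha⟩ := exists_natCast_eq_topologicalKrullDim hd hA
  obtain ⟨a', ha'⟩ := exists_natCast_eq_topologicalKrullDim hd hA'
  obtain ⟨b, hb⟩ := exists_natCast_eq_topologicalKrullDim hd hB
  obtain ⟨b', hb'⟩ := exists_natCast_eq_topologicalKrullDim hd hB'
  rw [ha, ha'] at hmA hsA
  rw [hb, hb'] at hmB hsB
  rw [ha, hb, ha', hb'] at h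
  norm_cast at h hmA hmB hsA hsB
  constructor
  · by_contra hne
    have := hsA (hAA.ssubset_of_ne hne)
    omega
  · by_contra hne
    have := hsB (hBB.ssubset_of_ne hne)
    omega


/-- Let `Z` be an irreducible topological space of finite dimension `d`, with two
finite partitions `Z = ⊔ᵢ X i = ⊔ⱼ Y j` into nonempty irreducible locally closed
subsets, each closure of a piece being a union of pieces of the same partition.
Assume:
(a) every nonempty intersection `X i ∩ Y j` is irreducible with
    `dim (X i ∩ Y j) + d = dim (X i) + dim (Y j)`, and
(b) every irreducible component `C` of `closure (X i) ∩ closure (Y j)` satisfies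
    `dim (X i) + dim (Y j) ≤ dim C + d`.
Then `X i ∩ Y j ≠ ∅` iff `closure (X i) ∩ closure (Y j) ≠ ∅`, and in this case
`closure (X i ∩ Y j) = closure (X i) ∩ closure (Y j)`; in particular `Z` is the
disjoint union of the nonempty intersections `X i ∩ Y j`.
(Here `dim S` of a subset `S` means the topological Krull dimension of its
closure.) -/
theorem closure_inter_of_compatible_partitions
    {Z : Type*} [TopologicalSpace Z] [IrreducibleSpace Z] (d : ℕ)
    (hdZ : topologicalKrullDim Z = (d : WithBot ℕ∞))
    {I J : Type*} [Finite I] [Finite J] (X : I → Set Z) (Y : J → Set Z)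
    (hXcover : ∀ z : Z, ∃! i : I, z ∈ X i)
    (hYcover : ∀ z : Z, ∃! j : J, z ∈ Y j)
    (hXne : ∀ i, (X i).Nonempty) (hYne : ∀ j, (Y j).Nonempty)
    (hXirr : ∀ i, IsIrreducible (X i)) (hYirr : ∀ j, IsIrreducible (Y j))
    (hXlc : ∀ i, IsLocallyClosed (X i)) (hYlc : ∀ j, IsLocallyClosed (Y j))
    (hXcl : ∀ i, ∃ s : Set I, closure (X i) = ⋃ i' ∈ s, X i')
    (hYcl : ∀ j, ∃ s : Set J, closure (Y j) = ⋃ j' ∈ s, Y j')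
    (ha : ∀ i j, (X i ∩ Y j).Nonempty →
      IsIrreducible (X i ∩ Y j) ∧
      topologicalKrullDim ↥(closure (X i ∩ Y j)) + (d : WithBot ℕ∞) =
        topologicalKrullDim ↥(closure (X i)) + topologicalKrullDim ↥(closure (Y j)))
    (hb : ∀ i j, ∀ C ∈ irreducibleComponents ↥(closure (X i) ∩ closure (Y j)),
      topologicalKrullDim ↥(closure (X i)) + topologicalKrullDim ↥(closure (Y j)) ≤
        topologicalKrullDim ↥C + (d : WithBot ℕ∞)) :
    (∀ i j, ((X i ∩ Y j).Nonempty ↔ (closure (X i) ∩ closure (Y j)).Nonempty) ∧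
      ((X i ∩ Y j).Nonempty → closure (X i ∩ Y j) = closure (X i) ∩ closure (Y j))) ∧
    (∀ z : Z, ∃! p : I × J, z ∈ X p.1 ∩ Y p.2) := by
  have hsub : ∀ i j, closure (X i) ∩ closure (Y j) ⊆ closure (X i ∩ Y j) := by
    intro i j z hz
    obtain ⟨s, hs⟩ := hXcl i
    obtain ⟨t, ht⟩ := hYcl j
    let C := irreducibleComponent (⟨z, hz⟩ : ↥(closure (X i) ∩ closure (Y j)))
    have hzC : z ∈ Subtype.val '' C := ⟨⟨z, hz⟩, mem_irreducibleComponent, rfl⟩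
    have hCirr : IsIrreducible (Subtype.val '' C) :=
      isIrreducible_irreducibleComponent.image _ continuous_subtype_val.continuousOn
    obtain ⟨⟨⟨i', hi'⟩, ⟨j', hj'⟩⟩, hC⟩ := hCirr.exists_subset_of_subset_iUnion
      (F := fun p : s × t ↦ closure (X p.1 ∩ Y p.2)) (fun _ ↦ isClosed_closure) (by
        rintro _ ⟨⟨w, hwX, hwY⟩, -, rfl⟩
        rw [hs] at hwX
        rw [ht] at hwY
        obtain ⟨i', hi', hwi⟩ := Set.mem_iUnion₂.1 hwX
        obtain ⟨j', hj', hwj⟩ := Set.mem_iUnion₂.1 hwY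
        exact Set.mem_iUnion.2 ⟨(⟨i', hi'⟩, ⟨j', hj'⟩), subset_closure ⟨hwi, hwj⟩⟩)
    have hX : closure (X i') ⊆ closure (X i) :=
      closure_minimal (hs ▸ Set.subset_biUnion_of_mem hi') isClosed_closure
    have hY : closure (Y j') ⊆ closure (Y j) :=
      closure_minimal (ht ▸ Set.subset_biUnion_of_mem hj') isClosed_closure
    have hCdim : topologicalKrullDim C ≤ topologicalKrullDim (closure (X i' ∩ Y j')) := by
      have hmaps : ∀ c : C, c.1.1 ∈ closure (X i' ∩ Y j') := fun c ↦ hC ⟨c.1, c.2, rfl⟩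
      exact ((Topology.IsInducing.subtypeVal.comp
        Topology.IsInducing.subtypeVal).codRestrict hmaps).topologicalKrullDim_le
    have hdim := (hb i j C (irreducibleComponent_mem_irreducibleComponents _)).trans
      (add_le_add_left hCdim _)
    rw [(ha i' j' (closure_nonempty_iff.1 ⟨z, hC hzC⟩)).2] at hdim
    obtain ⟨hXX, hYY⟩ := eq_and_eq_of_topologicalKrullDim_add_le hdZ.le (hXirr i).closure
      (hXirr i').closure (hYirr j).closure (hYirr j').closure isClosed_closure isClosed_closure
      hX hY hdim
    obtain ⟨x, hx, hx'⟩ := (hXlc i').inter_nonempty_of_closure_eq_s17 (hXne i') hXX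
    obtain ⟨y, hy, hy'⟩ := (hYlc j').inter_nonempty_of_closure_eq_s17 (hYne j') hYY
    obtain rfl := (hXcover x).unique hx hx'
    obtain rfl := (hYcover y).unique hy hy'
    exact hC hzC
  refine ⟨fun i j ↦ ⟨⟨fun h ↦ h.mono (Set.inter_subset_inter subset_closure subset_closure),
    fun h ↦ closure_nonempty_iff.1 (h.mono (hsub i j))⟩,
    fun _ ↦ closure_inter_subset_inter_closure _ _ |>.antisymm (hsub i j)⟩, fun z ↦ ?_⟩
  obtain ⟨i, hi, hiu⟩ := hXcover z
  obtain ⟨j, hj, hju⟩ := hYcover z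
  exact ⟨(i, j), ⟨hi, hj⟩, fun p hp ↦ Prod.ext (hiu _ hp.1) (hju _ hp.2)⟩
end
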